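/- For all integers r ≥ 1, D ≥ 1 and m with m ≥ D²/(4r) + D/2 + 1, the chromatic number of the SET-LOCAL neighborhood graph satisfies χ(N^SL_r(m, 2rD)) > D²/(4r). -/

import Mathlib

/-- The type of potential `r`-round views over the color set `[m]`: a `0`-view is a
color, and an `(r+1)`-view is a pair of an `r`-view and a set of `r`-views. -/
def ViewType (m : ℕ) : ℕ → Type
  | 0 => Fin m
  | r + 1 => ViewType m r × Set (ViewType m r)

/-- The `r`-view `S_r^G(v)` of a vertex `v` of a graph `G` whose vertices are colored
by `ψ`: `S_0^G(v) = ψ(v)` and `S_{r+1}^G(v) = (S_r^G(v), {S_r^G(u) : u ~ v})`,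
where the second component is the *set* of the neighbors' `r`-views. -/
def view {m : ℕ} {α : Type} (G : SimpleGraph α) (ψ : α → Fin m) :
    (r : ℕ) → α → ViewType m r
  | 0, v => ψ v
  | r + 1, v => (view G ψ r v, {s | ∃ u, G.Adj v u ∧ view G ψ r u = s})

/-- `x` is a realizable `r`-view for parameters `(m,Δ)`: it arises as the `r`-view of
some vertex of some finite tree of maximum degree at most `Δ` equipped with a proper
vertex coloring with colors in `[m]`. -/
def IsView (m Δ r : ℕ) (x : ViewType m r) : Prop :=
  ∃ (α : Type) (G : SimpleGraph α) (ψ : α → Fin m),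
    Finite α ∧ G.IsTree ∧ (∀ v, (G.neighborSet v).ncard ≤ Δ) ∧
    (∀ u v, G.Adj u v → ψ u ≠ ψ v) ∧ ∃ v, view G ψ r v = x

/-- Two `r`-views occur at adjacent vertices of some properly `m`-colored finite tree
with maximum degree at most `Δ`. -/
def ViewAdj (m Δ r : ℕ) (x y : ViewType m r) : Prop :=
  ∃ (α : Type) (G : SimpleGraph α) (ψ : α → Fin m),
    Finite α ∧ G.IsTree ∧ (∀ v, (G.neighborSet v).ncard ≤ Δ) ∧
    (∀ u v, G.Adj u v → ψ u ≠ ψ v) ∧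
    ∃ u v, G.Adj u v ∧ view G ψ r u = x ∧ view G ψ r v = y

/-- The vertices of the `SET-LOCAL` neighborhood graph `N^SL_r(m,Δ)`:
all realizable `r`-views. -/
def NSLVert (m Δ r : ℕ) : Type := {x : ViewType m r // IsView m Δ r x}

/-- The `SET-LOCAL` neighborhood graph `N^SL_r(m,Δ)`: realizable `r`-views, with an
edge between two views whenever they occur at adjacent vertices of some properly
`m`-colored finite tree with maximum degree at most `Δ`. -/
def NSL (m Δ r : ℕ) : SimpleGraph (NSLVert m Δ r) :=
  SimpleGraph.fromRel (fun x y => ViewAdj m Δ r x.val y.val)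

namespace ViewType

variable {m : ℕ}

/-- The underlying `k`-view of a `(k+1)`-view. -/
def prev {k : ℕ} (x : ViewType m (k + 1)) : ViewType m k := Prod.fst x

/-- The set of `k`-views of the neighbors recorded by a `(k+1)`-view. -/
def nbrs {k : ℕ} (x : ViewType m (k + 1)) : Set (ViewType m k) := Prod.snd x

/-- The color of the vertex from which a view is taken. -/
def color : (k : ℕ) → ViewType m k → Fin m
  | 0, a => a
  | k + 1, x => color k x.prev

/-- Local compatibility of two views as views of adjacent vertices. -/
def Compat : (k : ℕ) → ViewType m k → ViewType m k → Prop
  | 0, a, b => a ≠ b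
  | _ + 1, x, y => y.prev ∈ x.nbrs ∧ x.prev ∈ y.nbrs

/-- Every neighbor recorded by `p` is refined by some member of `P`. -/
def Refines : (k : ℕ) → ViewType m k → Set (ViewType m k) → Prop
  | 0, _, _ => True
  | _ + 1, p, P => ∀ z ∈ p.nbrs, ∃ q ∈ P, q.prev = z

/-- Views that are hereditarily consistent and have at most `k * D` neighbors at depth `k`. -/
def Good (D : ℕ) : (k : ℕ) → ViewType m k → Prop
  | 0, _ => True
  | k + 1, x => Good D k x.prev ∧ x.nbrs.Finite ∧ x.nbrs.ncard ≤ (k + 1) * D ∧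
      (∀ q ∈ x.nbrs, Good D k q ∧ Compat k x.prev q) ∧ Refines k x.prev x.nbrs

theorem Compat.symm : ∀ {k : ℕ} {x y : ViewType m k}, Compat k x y → Compat k y x
  | 0, _, _, h => Ne.symm h
  | _ + 1, _, _, h => ⟨h.2, h.1⟩

theorem Compat.color_ne {D : ℕ} : ∀ {k : ℕ} {x y : ViewType m k}, Good D k x →
    Compat k x y → color k x ≠ color k y
  | 0, _, _, _, h => h
  | k + 1, _, _, hx, h => Compat.color_ne (k := k) hx.1 (hx.2.2.2.1 _ h.1).2

theorem exists_good_extension {D : ℕ} (hD : 1 ≤ D) : ∀ (k : ℕ) (z : ViewType m k),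
    Good D k z → ∀ U : Set (ViewType m k), U.Finite → U.ncard ≤ D →
    (∀ u ∈ U, Good D k u ∧ Compat k z u) →
    ∃ x : ViewType m (k + 1), Good D (k + 1) x ∧ x.prev = z ∧ U ⊆ x.nbrs := by
  intro k
  induction k with
  | zero =>
    intro z hz U hU hc h
    exact ⟨(z, U), ⟨hz, hU, hc.trans (by simp), h, trivial⟩, rfl, subset_rfl⟩
  | succ k ih =>
    intro z hz U hU hc h
    have key : ∀ y ∈ z.nbrs, ∃ q : ViewType m (k + 1), Good D (k + 1) q ∧ q.prev = y ∧
        z.prev ∈ q.nbrs := by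
      intro y hy
      obtain ⟨q, h1, h2, h3⟩ := ih y (hz.2.2.2.1 y hy).1 {z.prev} (Set.finite_singleton _)
        (by simpa using hD) (by
          rintro u rfl
          exact ⟨hz.1, (hz.2.2.2.1 y hy).2.symm⟩)
      exact ⟨q, h1, h2, h3 rfl⟩
    have : Nonempty (ViewType m (k + 1)) := ⟨z⟩
    choose! f hf using key
    refine ⟨(z, U ∪ f '' z.nbrs), ⟨hz, hU.union (hz.2.1.image f), ?_, ?_, ?_⟩, rfl,
      Set.subset_union_left⟩
    · calc (U ∪ f '' z.nbrs).ncard ≤ U.ncard + (f '' z.nbrs).ncard := Set.ncard_union_le _ _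
        _ ≤ D + (k + 1) * D :=
          add_le_add hc ((Set.ncard_image_le hz.2.1).trans hz.2.2.1)
        _ = (k + 1 + 1) * D := by ring
    · rintro q (hq | ⟨y, hy, rfl⟩)
      · exact h q hq
      · refine ⟨(hf y hy).1, ?_, (hf y hy).2.2⟩
        rw [(hf y hy).2.1]
        exact hy
    · intro y hy
      exact ⟨f y, Or.inr ⟨y, hy, rfl⟩, (hf y hy).2.1⟩

/-- If `m ≥ c + D / 2 + 1`, then `c` independent sets of good `k`-views leave uncovered a clique of
size `D / 2 + 1 - k * (c / (D / 2 + 1))`. -/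
theorem exists_uncovered_clique {D c : ℕ} (hD : 1 ≤ D) (hm : c + (D / 2 + 1) ≤ m) :
    ∀ (k : ℕ) (I : Fin c → Set (ViewType m k)),
    (∀ γ, ∀ x ∈ I γ, ∀ y ∈ I γ, Good D k x → Good D k y → ¬ Compat k x y) →
    ∃ W : Finset (ViewType m k), W.card ≤ D / 2 + 1 ∧
      D / 2 + 1 ≤ W.card + k * (c / (D / 2 + 1)) ∧
      (∀ x ∈ W, Good D k x) ∧ (∀ x ∈ W, ∀ y ∈ W, x ≠ y → Compat k x y) ∧
      ∀ x ∈ W, ∀ γ, x ∉ I γ := by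
  classical
  intro k
  induction k with
  | zero =>
    intro I hI
    let U : Finset (Fin m) := Finset.univ.filter fun a => ∃ γ, I γ a
    have hU : U.card ≤ c := by
      have : ∀ a ∈ U, ∃ γ, I γ a := fun a ha => (Finset.mem_filter.1 ha).2
      rcases c.eq_zero_or_pos with rfl | hc
      · rw [Nat.le_zero, Finset.card_eq_zero, Finset.eq_empty_iff_forall_notMem]
        intro a ha
        exact (this a ha).choose.elim0
      · have : Nonempty (Fin c) := ⟨⟨0, hc⟩⟩
        choose! g hg using ‹∀ a ∈ U, ∃ γ, I γ a›
        have := Finset.card_le_card_of_injOn (s := U) (t := Finset.univ) g (by simp) (by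
          intro a ha b hb hab
          by_contra hne
          exact hI (g a) a (hg a ha) b (hab ▸ hg b hb) trivial trivial hne)
        simpa using this
    have hW : D / 2 + 1 ≤ Uᶜ.card := by
      rw [Finset.card_compl, Fintype.card_fin]
      omega
    obtain ⟨W, hW, hWc⟩ := Finset.exists_subset_card_eq hW
    refine ⟨W, hWc.le, Nat.le_add_right_of_le hWc.ge, fun _ _ => trivial, fun _ _ _ _ h => h, ?_⟩
    intro x hx γ hγ
    exact Finset.mem_compl.1 (hW hx) (Finset.mem_filter.2 ⟨Finset.mem_univ _, γ, hγ⟩)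
  | succ k ih =>
    intro I hI
    let J : Fin c → Set (ViewType m k) := fun γ => {p | ∀ q, Good D k q → Compat k p q →
      ∃ x ∈ I γ, Good D (k + 1) x ∧ x.prev = p ∧ q ∈ x.nbrs}
    obtain ⟨W, hW1, hW2, hWg, hWc, hWJ⟩ := ih J (by
      intro γ p hp p' hp' hg hg' hc
      obtain ⟨x, hx, hxg, hxp, hxn⟩ := hp p' hg' hc
      obtain ⟨y, hy, hyg, hyp, hyn⟩ := hp' p hg hc.symm
      exact hI γ x hx y hy hxg hyg ⟨hyp ▸ hxn, hxp ▸ hyn⟩)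
    let alive : ViewType m k → Finset (Fin c) := fun p => Finset.univ.filter fun γ =>
      ∃ x ∈ I γ, Good D (k + 1) x ∧ x.prev = p ∧ ∀ q ∈ W, q ≠ p → q ∈ x.nbrs
    have hdisj : (W : Set (ViewType m k)).PairwiseDisjoint alive := by
      intro p hp p' hp' hne
      refine Finset.disjoint_left.2 fun γ h h' => ?_
      obtain ⟨x, hx, hxg, hxp, hxn⟩ := (Finset.mem_filter.1 h).2
      obtain ⟨y, hy, hyg, hyp, hyn⟩ := (Finset.mem_filter.1 h').2
      exact hI γ x hx y hy hxg hyg ⟨hyp ▸ hxn p' hp' hne.symm, hxp ▸ hyn p hp hne⟩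
    let V := W.filter fun p => (alive p).card ≤ D / 2
    have hV : W.card ≤ V.card + c / (D / 2 + 1) := by
      have hsplit : V.card + (W.filter fun p => ¬ (alive p).card ≤ D / 2).card = W.card :=
        Finset.card_filter_add_card_filter_not _
      have hle : (W.filter fun p => ¬ (alive p).card ≤ D / 2).card ≤ c / (D / 2 + 1) := by
        rw [Nat.le_div_iff_mul_le (Nat.succ_pos _)]
        calc _ ≤ ∑ p ∈ W.filter (fun p => ¬ (alive p).card ≤ D / 2), (alive p).card := by
              rw [← smul_eq_mul]
              refine Finset.card_nsmul_le_sum _ _ _ fun p hp => ?_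
              have := (Finset.mem_filter.1 hp).2
              omega
          _ ≤ ∑ p ∈ W, (alive p).card :=
              Finset.sum_le_sum_of_subset (Finset.filter_subset _ _)
          _ = (W.biUnion alive).card := (Finset.card_biUnion hdisj).symm
          _ ≤ c := by simpa using Finset.card_le_univ (W.biUnion alive)
      omega
    have hext : ∀ p : ViewType m k, ∃ x : ViewType m (k + 1), p ∈ V → Good D (k + 1) x ∧ x.prev = p ∧
        (∀ q ∈ W, q ≠ p → q ∈ x.nbrs) ∧ ∀ γ, x ∉ I γ := by
      intro p
      by_cases hp : p ∉ V
      · exact ⟨(p, ∅), fun h => (hp h).elim⟩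
      rw [not_not] at hp
      obtain ⟨hpW, hpa⟩ := Finset.mem_filter.1 hp
      have hkill : ∀ γ, ∃ q, Good D k q ∧ Compat k p q ∧
          ∀ x ∈ I γ, Good D (k + 1) x → x.prev = p → q ∉ x.nbrs := by
        intro γ
        have := hWJ p hpW γ
        simp only [J, Set.mem_ofPred_eq] at this
        push Not at this
        exact this
      choose q hq1 hq2 hq3 using hkill
      let U : Finset (ViewType m k) := W.erase p ∪ (alive p).image q
      have hU : U.card ≤ D := by
        have h1 := Finset.card_union_le (W.erase p) ((alive p).image q)
        have h2 := Finset.card_image_le (s := alive p) (f := q)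
        have h3 := Finset.card_erase_of_mem hpW
        have h4 : U.card ≤ (W.erase p).card + ((alive p).image q).card := h1
        omega
      obtain ⟨x, hxg, hxp, hxU⟩ := exists_good_extension hD k p (hWg p hpW) U U.finite_toSet
        (by simpa using hU) (by
          intro u hu
          rcases Finset.mem_union.1 (Finset.mem_coe.1 hu) with h | h
          · obtain ⟨hne, h⟩ := Finset.mem_erase.1 h
            exact ⟨hWg u h, hWc p hpW u h hne.symm⟩
          · obtain ⟨γ, -, rfl⟩ := Finset.mem_image.1 h
            exact ⟨hq1 γ, hq2 γ⟩)
      have hxW : ∀ q ∈ W, q ≠ p → q ∈ x.nbrs := fun u hu hne =>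
        hxU (Finset.mem_coe.2 (Finset.mem_union_left _ (Finset.mem_erase.2 ⟨hne, hu⟩)))
      refine ⟨x, fun _ => ⟨hxg, hxp, hxW, fun γ hγ => ?_⟩⟩
      have hmem : γ ∈ alive p :=
        Finset.mem_filter.2 ⟨Finset.mem_univ _, x, hγ, hxg, hxp, hxW⟩
      exact hq3 γ x hγ hxg hxp
        (hxU (Finset.mem_coe.2 (Finset.mem_union_right _ (Finset.mem_image_of_mem q hmem))))
    choose f hf using hext
    have hcard : (V.image f).card = V.card := Finset.card_image_of_injOn (by
      intro p hp p' hp' h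
      rw [← (hf p hp).2.1, ← (hf p' hp').2.1, h])
    refine ⟨V.image f, ?_, ?_, ?_, ?_, ?_⟩
    · rw [hcard]
      exact (Finset.card_filter_le _ _).trans hW1
    · rw [hcard, add_mul, one_mul]
      omega
    · intro x hx
      obtain ⟨p, hp, rfl⟩ := Finset.mem_image.1 hx
      exact (hf p hp).1
    · intro x hx y hy hne
      obtain ⟨p, hp, rfl⟩ := Finset.mem_image.1 hx
      obtain ⟨p', hp', rfl⟩ := Finset.mem_image.1 hy
      have hpp : p ≠ p' := fun h => hne (h ▸ rfl)
      refine ⟨?_, ?_⟩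
      · rw [(hf p' hp').2.1]
        exact (hf p hp).2.2.1 p' (Finset.mem_filter.1 hp').1 hpp.symm
      · rw [(hf p hp).2.1]
        exact (hf p' hp').2.2.1 p (Finset.mem_filter.1 hp).1 hpp
    · intro x hx
      obtain ⟨p, hp, rfl⟩ := Finset.mem_image.1 hx
      exact (hf p hp).2.2.2

/-- `Restricts k x ⟨j, y⟩` says that `y` is the truncation of the `k`-view `x` to depth `j ≤ k`. -/
def Restricts : (k : ℕ) → ViewType m k → (Σ j, ViewType m j) → Prop
  | 0, x, s => s = ⟨0, x⟩
  | k + 1, x, s => s = ⟨k + 1, x⟩ ∨ Restricts k x.prev s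

theorem Restricts.refl : ∀ (k : ℕ) (x : ViewType m k), Restricts k x ⟨k, x⟩
  | 0, _ => rfl
  | _ + 1, _ => Or.inl rfl

theorem Restricts.prev {j : ℕ} {y : ViewType m (j + 1)} : ∀ {k : ℕ} {x : ViewType m k},
    Restricts k x ⟨j + 1, y⟩ → Restricts k x ⟨j, y.prev⟩
  | 0, _, h => by cases h
  | k + 1, x, h => by
    rcases h with h | h
    · cases h
      exact Or.inr (Restricts.refl _ _)
    · exact Or.inr h.prev

theorem Restricts.color_eq {a : ViewType m 0} : ∀ {k : ℕ} {x : ViewType m k},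
    Restricts k x ⟨0, a⟩ → color k x = a
  | 0, _, h => by
    cases h
    rfl
  | k + 1, x, h => by
    rcases h with h | h
    · cases h
    · exact h.color_eq

theorem Restricts.exists_nbr {D j : ℕ} {y : ViewType m (j + 1)} :
    ∀ {k : ℕ} {x : ViewType m (k + 1)}, Good D (k + 1) x → Restricts (k + 1) x ⟨j + 1, y⟩ →
    ∀ q ∈ y.nbrs, ∃ z ∈ x.nbrs, Restricts k z ⟨j, q⟩
  | k, x, hx, h, q, hq => by
    rcases h with h | h
    · cases h
      exact ⟨q, hq, Restricts.refl _ _⟩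
    · cases k with
      | zero => cases h
      | succ k =>
        obtain ⟨z, hz, hzq⟩ := Restricts.exists_nbr hx.1 h q hq
        obtain ⟨z', hz', rfl⟩ := hx.2.2.2.2 z hz
        exact ⟨z', hz', Or.inr hzq⟩

theorem Restricts.exists_restricts {D j : ℕ} {y : ViewType m (j + 1)} :
    ∀ {k : ℕ} {x : ViewType m (k + 1)}, Good D (k + 1) x → Restricts (k + 1) x ⟨j + 1, y⟩ →
    ∀ z ∈ x.nbrs, ∃ q ∈ y.nbrs, Restricts k z ⟨j, q⟩
  | k, x, hx, h, z, hz => by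
    rcases h with h | h
    · cases h
      exact ⟨z, hz, Restricts.refl _ _⟩
    · cases k with
      | zero => cases h
      | succ k =>
        obtain ⟨q, hq, hzq⟩ :=
          Restricts.exists_restricts hx.1 h z.prev (hx.2.2.2.1 z hz).2.1
        exact ⟨q, hq, Or.inr hzq⟩

/-- The views recorded by a view, with `0`-views recording none. -/
def children : (Σ k, ViewType m k) → Set (Σ k, ViewType m k)
  | ⟨0, _⟩ => ∅
  | ⟨k + 1, x⟩ => Sigma.mk k '' x.nbrs

/-- Vertices with intended views `s` and `t` may be joined by an edge, as far as `s` is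
concerned. -/
def Joinable (s t : Σ k, ViewType m k) : Prop :=
  color s.1 s.2 ≠ color t.1 t.2 ∧ ∀ (j : ℕ) (y : ViewType m (j + 1)),
    Restricts s.1 s.2 ⟨j + 1, y⟩ → ∃ q ∈ y.nbrs, Restricts t.1 t.2 ⟨j, q⟩

theorem Compat.joinable {D : ℕ} : ∀ {k : ℕ} {x y : ViewType m k}, Good D k x →
    Compat k x y → Joinable ⟨k, x⟩ ⟨k, y⟩
  | 0, _, _, _, h => ⟨h, fun _ _ hr => by cases hr⟩
  | k + 1, x, y, hx, h => by
    refine ⟨h.color_ne hx, fun j z hz => ?_⟩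
    obtain ⟨q, hq, hr⟩ := hz.exists_restricts hx _ h.1
    exact ⟨q, hq, Or.inr hr⟩

theorem joinable_child {D : ℕ} {s t : Σ k, ViewType m k} (hs : Good D s.1 s.2)
    (ht : t ∈ children s) : Joinable s t ∧ Joinable t s ∧ Good D t.1 t.2 := by
  obtain ⟨_ | k, x⟩ := s
  · exact ht.elim
  · obtain ⟨y, hy, rfl⟩ := ht
    obtain ⟨hyg, hc⟩ := hs.2.2.2.1 y hy
    have hj := hc.symm.joinable hyg
    refine ⟨⟨hj.1.symm, fun j z hz => hz.exists_restricts hs y hy⟩, ⟨hj.1, fun j z hz => ?_⟩, hyg⟩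
    obtain ⟨q, hq, hr⟩ := hj.2 j z hz
    exact ⟨q, hq, Or.inr hr⟩

end ViewType

/-- A labelling of the vertices by views that satisfies the recursion locally gives the true
views. -/
theorem view_eq_of_local {m : ℕ} {α : Type} (G : SimpleGraph α) (ψ : α → Fin m)
    (R : α → (k : ℕ) → ViewType m k → Prop) (h0 : ∀ v a, R v 0 a → ψ v = a)
    (h1 : ∀ v k x, R v (k + 1) x → R v k x.prev)
    (h2 : ∀ v k x, R v (k + 1) x → ∀ q ∈ x.nbrs, ∃ u, G.Adj v u ∧ R u k q)
    (h3 : ∀ v k x, R v (k + 1) x → ∀ u, G.Adj v u → ∃ q ∈ x.nbrs, R u k q) :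
    ∀ k v x, R v k x → view G ψ k v = x := by
  intro k
  induction k with
  | zero => exact h0
  | succ k ih =>
    intro v x hx
    refine Prod.ext (ih v _ (h1 v k x hx)) (Set.ext fun s => ⟨?_, fun hs => ?_⟩)
    · rintro ⟨u, hu, rfl⟩
      obtain ⟨q, hq, hr⟩ := h3 v k x hx u hu
      rw [ih u q hr]
      exact hq
    · obtain ⟨u, hu, hr⟩ := h2 v k x hx s hs
      exact ⟨u, hu, ih u s hr⟩

namespace SimpleGraph

/-- The graph joining each vertex other than `root` to its parent. -/
def ofParent {α : Type*} (root : α) (parent : α → α) : SimpleGraph α :=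
  fromRel fun u v => u ≠ root ∧ parent u = v

theorem isTree_ofParent {α : Type*} [Finite α] (root : α) (parent : α → α) (depth : α → ℕ)
    (h : ∀ v, v ≠ root → depth (parent v) < depth v) : (ofParent root parent).IsTree := by
  have hadj : ∀ v, v ≠ root → (ofParent root parent).Adj v (parent v) := fun v hv =>
    (fromRel_adj _ _ _).2 ⟨fun he => (h v hv).ne (he ▸ rfl), Or.inl ⟨hv, rfl⟩⟩
  have hreach : ∀ n v, depth v = n → (ofParent root parent).Reachable v root := by
    intro n
    induction n using Nat.strong_induction_on with
    | _ n ih =>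
      intro v hv
      by_cases hr : v = root
      · rw [hr]
      · exact (hadj v hr).reachable.trans (ih _ (hv ▸ h v hr) _ rfl)
  have hconn : (ofParent root parent).Connected := by
    have : Nonempty α := ⟨root⟩
    exact Connected.mk fun u v => (hreach _ u rfl).trans (hreach _ v rfl).symm
  refine isTree_iff_connected_and_card.2 ⟨hconn, le_antisymm ?_ ?_⟩
  · have hsub : (ofParent root parent).edgeSet ⊆ (fun v => s(v, parent v)) '' {root}ᶜ := by
      intro e
      induction e using Sym2.ind with
      | _ u v =>
        intro he
        rcases ((fromRel_adj (fun u v => u ≠ root ∧ parent u = v) u v).1 he).2 with ⟨hu, rfl⟩ | ⟨hv, rfl⟩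
        · exact ⟨u, hu, rfl⟩
        · exact ⟨v, hv, Sym2.eq_swap⟩
    have h1 := Set.ncard_le_ncard hsub (Set.toFinite _)
    have h2 := Set.ncard_image_le (f := fun v => s(v, parent v)) (Set.toFinite ({root}ᶜ : Set α))
    have h3 := Set.ncard_add_ncard_compl ({root} : Set α)
    rw [Set.ncard_singleton] at h3
    rw [Nat.card_coe_set_eq]
    omega
  · exact hconn.card_vert_le_card_edgeSet_add_one

end SimpleGraph

namespace ViewType

variable {m : ℕ}

/-- The intended view at the end of a descending path starting at a vertex with view `s`. -/
def endpoint (s : Σ k, ViewType m k) (l : List (Σ k, ViewType m k)) : Σ k, ViewType m k :=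
  l.headD s

/-- Descending paths, listed from the end, in the unfolding of the view `s`; the root has the
members of `E` as additional children. -/
def IsPath (s : Σ k, ViewType m k) (E : Set (Σ k, ViewType m k)) :
    List (Σ k, ViewType m k) → Prop
  | [] => True
  | t :: l => IsPath s E l ∧ (t ∈ children (endpoint s l) ∨ l = [] ∧ t ∈ E)

theorem IsPath.tail {s : Σ k, ViewType m k} {E : Set (Σ k, ViewType m k)} :
    ∀ {l : List (Σ k, ViewType m k)}, IsPath s E l → IsPath s E l.tail
  | [], h => h
  | _ :: _, h => h.1

theorem Good.finite_children {D : ℕ} : ∀ {s : Σ k, ViewType m k}, Good D s.1 s.2 →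
    (children s).Finite ∧ (children s).ncard ≤ s.1 * D
  | ⟨0, _⟩, _ => by simp [children]
  | ⟨_ + 1, _⟩, h => ⟨h.2.1.image _, (Set.ncard_image_le h.2.1).trans h.2.2.1⟩

theorem children_fst {s t : Σ k, ViewType m k} (h : t ∈ children s) : t.1 + 1 = s.1 := by
  obtain ⟨_ | k, x⟩ := s
  · exact h.elim
  · obtain ⟨y, -, rfl⟩ := h
    rfl

section Unfolding

variable {D r : ℕ} {x : ViewType m r} {E : Set (Σ k, ViewType m k)}

theorem IsPath.good (hx : Good D r x)
    (hE : ∀ t ∈ E, ∃ y, t = ⟨r, y⟩ ∧ Good D r y ∧ Compat r x y) :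
    ∀ {l : List (Σ k, ViewType m k)}, IsPath ⟨r, x⟩ E l →
      Good D (endpoint ⟨r, x⟩ l).1 (endpoint ⟨r, x⟩ l).2 ∧
      (endpoint ⟨r, x⟩ l).1 + l.length ≤ r + 1
  | [], _ => ⟨hx, Nat.le_succ r⟩
  | t :: l, h => by
    obtain ⟨hg, hl⟩ := IsPath.good hx hE h.1
    rcases h.2 with ht | ⟨rfl, ht⟩
    · refine ⟨(joinable_child hg ht).2.2, ?_⟩
      have := children_fst ht
      change t.1 + (l.length + 1) ≤ r + 1
      omega
    · obtain ⟨y, rfl, hy, -⟩ := hE t ht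
      exact ⟨hy, le_rfl⟩

theorem IsPath.joinable (hx : Good D r x)
    (hE : ∀ t ∈ E, ∃ y, t = ⟨r, y⟩ ∧ Good D r y ∧ Compat r x y)
    {t : Σ k, ViewType m k} {l : List (Σ k, ViewType m k)} (h : IsPath ⟨r, x⟩ E (t :: l)) :
    Joinable (endpoint ⟨r, x⟩ l) t ∧ Joinable t (endpoint ⟨r, x⟩ l) := by
  rcases h.2 with ht | ⟨rfl, ht⟩
  · have := joinable_child (h.1.good hx hE).1 ht
    exact ⟨this.1, this.2.1⟩
  · obtain ⟨y, rfl, hy, hc⟩ := hE t ht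
    exact ⟨hc.joinable hx, hc.symm.joinable hy⟩

theorem finite_isPath (hx : Good D r x) (hfin : E.Finite)
    (hE : ∀ t ∈ E, ∃ y, t = ⟨r, y⟩ ∧ Good D r y ∧ Compat r x y) :
    {l | IsPath ⟨r, x⟩ E l}.Finite := by
  have hlen : ∀ n, {l | IsPath ⟨r, x⟩ E l ∧ l.length = n}.Finite := by
    intro n
    induction n with
    | zero =>
      refine (Set.finite_singleton []).subset ?_
      rintro l ⟨-, hl⟩
      exact List.length_eq_zero_iff.1 hl
    | succ n ih =>
      refine (ih.biUnion (t := fun l => (fun t => t :: l) ''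
        ({t | t ∈ children (endpoint ⟨r, x⟩ l)} ∪ E)) ?_).subset ?_
      · rintro l ⟨hl, -⟩
        exact ((hl.good hx hE).1.finite_children.1.union hfin).image _
      · rintro (_ | ⟨t, l⟩) ⟨hl, hn⟩
        · simp at hn
        · refine Set.mem_biUnion (x := l) ⟨hl.1, by simpa using hn⟩ ⟨t, ?_, rfl⟩
          exact hl.2.imp id And.right
  refine ((Set.finite_Iic (r + 1)).biUnion fun n _ => hlen n).subset fun l hl => ?_
  have := (IsPath.good hx hE hl).2
  exact Set.mem_biUnion (x := l.length) (by simp only [Set.mem_Iic]; omega) ⟨hl, rfl⟩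

/-- The unfolding of a good `r`-view, whose root may be given one further compatible child, is a
properly colored tree in which the root and the additional child have the intended views. -/
theorem exists_tree (hx : Good D r x) (hsub : E.Subsingleton)
    (hE : ∀ t ∈ E, ∃ y, t = ⟨r, y⟩ ∧ Good D r y ∧ Compat r x y) :
    ∃ (α : Type) (G : SimpleGraph α) (ψ : α → Fin m),
      Finite α ∧ G.IsTree ∧ (∀ v, (G.neighborSet v).ncard ≤ r * D + 1) ∧
      (∀ u v, G.Adj u v → ψ u ≠ ψ v) ∧ ∃ u, view G ψ r u = x ∧
        ∀ y, ⟨r, y⟩ ∈ E → ∃ v, G.Adj u v ∧ view G ψ r v = y := by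
  let α := {l // IsPath ⟨r, x⟩ E l}
  have : Finite α := (finite_isPath hx hsub.finite hE).to_subtype
  let root : α := ⟨[], trivial⟩
  let parent : α → α := fun v => ⟨v.1.tail, v.2.tail⟩
  let G := SimpleGraph.ofParent root parent
  let e : α → Σ k, ViewType m k := fun v => endpoint ⟨r, x⟩ v.1
  let ψ : α → Fin m := fun v => color (e v).1 (e v).2
  have hadj : ∀ u v : α, G.Adj u v → (∃ t, u.1 = t :: v.1) ∨ ∃ t, v.1 = t :: u.1 := by
    have key : ∀ u v : α, u ≠ root → parent u = v → ∃ t, u.1 = t :: v.1 := by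
      rintro ⟨_ | ⟨t, l⟩, hl⟩ v hne rfl
      · exact (hne rfl).elim
      · exact ⟨t, rfl⟩
    intro u v h
    rcases ((SimpleGraph.fromRel_adj _ _ _).1 h).2 with ⟨hu, h⟩ | ⟨hv, h⟩
    · exact Or.inl (key u v hu h)
    · exact Or.inr (key v u hv h)
  have hcons : ∀ (u v : α) t, v.1 = t :: u.1 → G.Adj u v := by
    intro u v t h
    refine (SimpleGraph.fromRel_adj _ _ _).2 ⟨?_, Or.inr ⟨?_, ?_⟩⟩
    · rintro rfl
      simpa using congrArg List.length h
    · rintro rfl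
      cases h
    · exact Subtype.ext (by simp [parent, h])
  have hjoin : ∀ u v : α, G.Adj u v → Joinable (e u) (e v) := by
    have key : ∀ (u v : α) t, v.1 = t :: u.1 →
        Joinable (e u) (e v) ∧ Joinable (e v) (e u) := by
      rintro u ⟨_, hv⟩ t rfl
      exact hv.joinable hx hE
    intro u v h
    rcases hadj u v h with ⟨t, ht⟩ | ⟨t, ht⟩
    · exact (key v u t ht).2
    · exact (key u v t ht).1
  have hview := view_eq_of_local G ψ (fun v k y => Restricts (e v).1 (e v).2 ⟨k, y⟩)
    (fun v a h => h.color_eq) (fun v k y h => h.prev) (by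
      intro v k y h q hq
      have hg : Good D (e v).1 (e v).2 := (v.2.good hx hE).1
      have hchild : ∀ t ∈ children (e v), ∃ u, G.Adj v u ∧ e u = t := fun t ht =>
        ⟨⟨t :: v.1, v.2, Or.inl ht⟩, hcons _ _ t rfl, rfl⟩
      revert h hg hchild
      generalize e v = s
      intro h hg hchild
      obtain ⟨_ | k', z⟩ := s
      · cases h
      · obtain ⟨z', hz', hr⟩ := Restricts.exists_nbr hg h q hq
        obtain ⟨u, hu, hue⟩ := hchild ⟨k', z'⟩ ⟨z', hz', rfl⟩
        refine ⟨u, hu, ?_⟩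
        rw [hue]
        exact hr)
    (fun v k y h u hu => (hjoin v u hu).2 k y h)
  refine ⟨α, G, ψ, this, ?_, ?_, fun u v h => (hjoin u v h).1, root,
    hview r root x (Restricts.refl r x), fun y hy => ?_⟩
  · refine SimpleGraph.isTree_ofParent root parent (fun v => v.1.length) ?_
    rintro ⟨_ | ⟨t, l⟩, hl⟩ hne
    · exact (hne rfl).elim
    · exact Nat.lt_succ_self _
  · intro v
    have hg := v.2.good hx hE
    have hlev : (e v).1 ≤ r := by
      obtain ⟨_ | ⟨t, l⟩, hl⟩ := v
      · exact le_rfl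
      · have := hg.2
        simp only [List.length_cons] at this
        change (endpoint ⟨r, x⟩ (t :: l)).1 ≤ r
        omega
    obtain ⟨a, ha⟩ : ∃ a, Subtype.val '' G.neighborSet v ⊆
        insert a ((fun t => t :: v.1) '' children (e v)) := by
      have hext : ∃ a, (∀ t ∈ E, v.1 = [] → [t] = a) ∧ (v.1 ≠ [] → v.1.tail = a) := by
        by_cases hv : v.1 = []
        · rcases E.eq_empty_or_nonempty with hE | ⟨t, ht⟩
          · exact ⟨[], by simp [hE], fun h => (h hv).elim⟩
          · exact ⟨[t], fun t' ht' _ => by rw [hsub ht' ht], fun h => (h hv).elim⟩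
        · exact ⟨v.1.tail, fun _ _ h => (hv h).elim, fun _ => rfl⟩
      obtain ⟨a, h1, h2⟩ := hext
      refine ⟨a, ?_⟩
      rintro _ ⟨⟨l, hl⟩, hu, rfl⟩
      rcases hadj v _ hu with ⟨t, ht⟩ | ⟨t, rfl⟩
      · left
        rw [← h2 (by simp [ht])]
        simp [ht]
      · rcases hl.2 with h | ⟨hn, h⟩
        · exact Or.inr ⟨t, h, rfl⟩
        · left
          rw [← h1 t h hn]
          simp only [hn]
    have hfin := hg.1.finite_children
    calc (G.neighborSet v).ncard = (Subtype.val '' G.neighborSet v).ncard :=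
          (Set.ncard_image_of_injective _ Subtype.val_injective).symm
      _ ≤ _ := Set.ncard_le_ncard ha ((hfin.1.image _).insert _)
      _ ≤ _ := Set.ncard_insert_le _ _
      _ ≤ (children (e v)).ncard + 1 := Nat.succ_le_succ (Set.ncard_image_le hfin.1)
      _ ≤ r * D + 1 := Nat.succ_le_succ (hfin.2.trans (Nat.mul_le_mul_right D hlev))
  · exact ⟨⟨[⟨r, y⟩], trivial, Or.inr ⟨rfl, hy⟩⟩, hcons _ _ _ rfl,
      hview r _ y (Restricts.refl r y)⟩

end Unfolding

theorem Good.isView {D Δ r : ℕ} (hΔ : r * D + 1 ≤ Δ) {x : ViewType m r} (hx : Good D r x) :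
    IsView m Δ r x := by
  obtain ⟨α, G, ψ, h1, h2, h3, h4, u, h5, -⟩ :=
    exists_tree (E := ∅) hx Set.subsingleton_empty (by simp)
  exact ⟨α, G, ψ, h1, h2, fun v => (h3 v).trans hΔ, h4, u, h5⟩

theorem Compat.viewAdj {D Δ r : ℕ} (hΔ : r * D + 1 ≤ Δ) {x y : ViewType m r} (hx : Good D r x)
    (hy : Good D r y) (h : Compat r x y) : ViewAdj m Δ r x y := by
  obtain ⟨α, G, ψ, h1, h2, h3, h4, u, h5, h6⟩ :=
    exists_tree (E := {⟨r, y⟩}) hx Set.subsingleton_singleton (by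
      rintro _ rfl
      exact ⟨y, rfl, hy, h⟩)
  obtain ⟨v, huv, hv⟩ := h6 y rfl
  exact ⟨α, G, ψ, h1, h2, fun v => (h3 v).trans hΔ, h4, u, v, huv, h5, hv⟩

end ViewType

/-- For all integers `r ≥ 1`, `D ≥ 1` and `m ≥ D²/(4r) + D/2 + 1`, every proper
vertex coloring of the `SET-LOCAL` neighborhood graph `N^SL_r(m,2rD)` uses more than
`D²/(4r)` colors, i.e. `χ(N^SL_r(m,2rD)) > D²/(4r)`. -/
theorem NSL_chromatic_lower_bound (r D m : ℕ) (hr : 1 ≤ r) (hD : 1 ≤ D)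
    (hm : (D : ℚ) ^ 2 / (4 * (r : ℚ)) + (D : ℚ) / 2 + 1 ≤ (m : ℚ)) (c : ℕ)
    (hc : (NSL m (2 * r * D) r).Colorable c) :
    (D : ℚ) ^ 2 / (4 * (r : ℚ)) < (c : ℚ) := by
  by_contra! hcon
  have hr0 : (0 : ℚ) < 4 * (r : ℚ) := by positivity
  have hcD : c * (4 * r) ≤ D ^ 2 := by
    rw [le_div_iff₀ hr0] at hcon
    exact_mod_cast hcon
  have hmc : c + (D / 2 + 1) ≤ m := by
    have h : 2 * c + D + 2 ≤ 2 * m := by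
      have : (2 * c + D + 2 : ℚ) ≤ 2 * m := by linarith
      exact_mod_cast this
    omega
  have hΔ : r * D + 1 ≤ 2 * r * D := by
    have := Nat.mul_le_mul hr hD
    linarith
  obtain ⟨φ⟩ := hc
  obtain ⟨W, -, hW, hWg, -, hWI⟩ := ViewType.exists_uncovered_clique hD hmc r
    (fun γ => {x | ∃ h : IsView m (2 * r * D) r x, φ ⟨x, h⟩ = γ}) (by
      rintro γ x ⟨hx, hxγ⟩ y ⟨hy, hyγ⟩ hxg hyg hc
      refine φ.valid (v := ⟨x, hx⟩) (w := ⟨y, hy⟩) ?_ (hxγ.trans hyγ.symm)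
      refine (SimpleGraph.fromRel_adj _ _ _).2 ⟨fun h => ?_, Or.inl (hc.viewAdj hΔ hxg hyg)⟩
      exact hc.color_ne hxg (congrArg (ViewType.color r) (congrArg Subtype.val h)))
  have hlt : r * (c / (D / 2 + 1)) < D / 2 + 1 := by
    by_contra! hge
    have h1 := Nat.div_mul_le_self c (D / 2 + 1)
    have h2 : D < 2 * (D / 2 + 1) := by omega
    generalize D / 2 + 1 = K at *
    generalize c / K = t at *
    have h3 : 4 * (K * K) ≤ c * (4 * r) := by
      calc 4 * (K * K) ≤ 4 * (r * t * K) := by gcongr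
        _ = t * K * (4 * r) := by ring
        _ ≤ c * (4 * r) := by gcongr
    nlinarith
  obtain ⟨x, hx⟩ : W.Nonempty := Finset.card_pos.1 (by omega)
  exact hWI x hx _ ⟨(hWg x hx).isView hΔ, rfl⟩
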